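/- There exists a polynomial P such that for every set S of N points in the plane in general position, the number of bi-connected plane graphs on S is at most P(N) · 180.20^N; that is, this number is O*(180.20^N). -/

import Mathlib

open scoped Classical

noncomputable section

/-- A point in the plane. -/
abbrev Pt : Type := ℝ × ℝ

/-- `S` is in general position: no three distinct points of `S` are collinear. -/
def GenPos (S : Finset Pt) : Prop :=
  ∀ p ∈ S, ∀ q ∈ S, ∀ r ∈ S, p ≠ q → p ≠ r → q ≠ r →
    ¬ Collinear ℝ ({p, q, r} : Set Pt)

/-- Two straight edges cross if their relative interiors (open segments) meet. -/
def EdgesCross (e f : Sym2 Pt) : Prop :=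
  ∃ a b c d : Pt, e = s(a, b) ∧ f = s(c, d) ∧
    (openSegment ℝ a b ∩ openSegment ℝ c d).Nonempty

/-- `G` is a crossing-free straight-edge (plane) graph on the point set `S`:
its edges are nondegenerate straight segments between points of `S`,
and no two distinct edges cross. -/
def IsPlaneGraph (S : Finset Pt) (G : Finset (Sym2 Pt)) : Prop :=
  (∀ e ∈ G, ¬ e.IsDiag ∧ ∀ p ∈ e, p ∈ S) ∧
    ∀ e ∈ G, ∀ f ∈ G, e ≠ f → ¬ EdgesCross e f

/-- The (finite) collection of all plane graphs on `S`. -/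
def planeGraphs (S : Finset Pt) : Finset (Finset (Sym2 Pt)) :=
  S.sym2.powerset.filter (IsPlaneGraph S)

/-- The degree of the point `p` in the graph `G`. -/
def vingDeg (G : Finset (Sym2 Pt)) (p : Pt) : ℕ :=
  (G.filter fun e => p ∈ e).card

/-- The ving `(p, G)` is an x-ving: no straight edge from `p` to another point
of `S` can be added to `G` while keeping the graph plane. -/
def IsXVing (S : Finset Pt) (G : Finset (Sym2 Pt)) (p : Pt) : Prop :=
  ∀ q ∈ S, q ≠ p → s(p, q) ∉ G → ¬ IsPlaneGraph S (insert s(p, q) G)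

/-- `v_x(G)`: the number of x-vings of `G`. -/
def vx (S : Finset Pt) (G : Finset (Sym2 Pt)) : ℕ :=
  (S.filter (IsXVing S G)).card

/-- `v_i(G)`: the number of vertices of degree exactly `i` in `G`. -/
def vdeg (S : Finset Pt) (G : Finset (Sym2 Pt)) (i : ℕ) : ℕ :=
  (S.filter fun p => vingDeg G p = i).card

/-- `ĥv_x(S)`: the average of `v_x(G)` over a uniformly random plane graph on `S`. -/
def hvx (S : Finset Pt) : ℝ :=
  (∑ G ∈ planeGraphs S, (vx S G : ℝ)) / (planeGraphs S).card

/-- `ĥv_i(S)`: the average of `v_i(G)` over a uniformly random plane graph on `S`. -/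
def hvdeg (S : Finset Pt) (i : ℕ) : ℝ :=
  (∑ G ∈ planeGraphs S, (vdeg S G i : ℝ)) / (planeGraphs S).card

/-- `pg(N)`: the maximum number of plane graphs over all sets of `N` points in
general position. -/
def pgMax (N : ℕ) : ℕ :=
  sSup {n : ℕ | ∃ S : Finset Pt, S.card = N ∧ GenPos S ∧ (planeGraphs S).card = n}

/-- The plane graphs on `S` with at most `m` edges. -/
def planeGraphsLE (S : Finset Pt) (m : ℝ) : Finset (Finset (Sym2 Pt)) :=
  (planeGraphs S).filter fun G => (G.card : ℝ) ≤ m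

/-- `ĥv_{x,m}(S)`: the average of `v_x(G)` over a uniformly random plane graph
on `S` with at most `m` edges. -/
def hvxLE (S : Finset Pt) (m : ℝ) : ℝ :=
  (∑ G ∈ planeGraphsLE S m, (vx S G : ℝ)) / (planeGraphsLE S m).card

/-- `G` has no vertex (point of `S`) of degree smaller than `i`. -/
def MinDegGe (S : Finset Pt) (G : Finset (Sym2 Pt)) (i : ℕ) : Prop :=
  ∀ p ∈ S, i ≤ vingDeg G p

/-- The plane graphs on `S` with no vertex of degree smaller than `i`. -/
def planeGraphsDeg (S : Finset Pt) (i : ℕ) : Finset (Finset (Sym2 Pt)) :=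
  (planeGraphs S).filter fun G => MinDegGe S G i

/-- The plane graphs on `S` with at most `m` edges and no vertex of degree
smaller than `i`. -/
def planeGraphsLEDeg (S : Finset Pt) (m : ℝ) (i : ℕ) : Finset (Finset (Sym2 Pt)) :=
  (planeGraphs S).filter fun G => (G.card : ℝ) ≤ m ∧ MinDegGe S G i

/-- `ĥv_{x,m}(S,i)`: the average of `v_x(G)` over a uniformly random plane graph
on `S` with at most `m` edges and no vertex of degree smaller than `i`. -/
def hvxLEDeg (S : Finset Pt) (m : ℝ) (i : ℕ) : ℝ :=
  (∑ G ∈ planeGraphsLEDeg S m i, (vx S G : ℝ)) / (planeGraphsLEDeg S m i).card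

/-- `pg(N, i)`: the maximum, over sets `S` of `N` points in general position, of
the number of plane graphs on `S` with no vertex of degree smaller than `i`. -/
def pgMaxDeg (N i : ℕ) : ℕ :=
  sSup {n : ℕ | ∃ S : Finset Pt, S.card = N ∧ GenPos S ∧ (planeGraphsDeg S i).card = n}

/-- The underlying abstract graph of `G` on the vertex set `S`. -/
def abstractGraph (S : Finset Pt) (G : Finset (Sym2 Pt)) :
    SimpleGraph (S : Set Pt) :=
  SimpleGraph.induce (S : Set Pt) (SimpleGraph.fromEdgeSet (G : Set (Sym2 Pt)))

/-- The connected plane graphs on `S`. -/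
def connPlaneGraphs (S : Finset Pt) : Finset (Finset (Sym2 Pt)) :=
  (planeGraphs S).filter fun G => (abstractGraph S G).Connected

/-- The underlying abstract graph of `G` is bi-connected (2-vertex-connected):
it is connected and remains connected after deletion of any single vertex. -/
def Biconnected (S : Finset Pt) (G : Finset (Sym2 Pt)) : Prop :=
  (abstractGraph S G).Connected ∧
    ∀ v ∈ S, (SimpleGraph.induce ((S : Set Pt) \ {v})
      (SimpleGraph.fromEdgeSet (G : Set (Sym2 Pt)))).Connected

/-- The bi-connected plane graphs on `S`. -/
def biconnPlaneGraphs (S : Finset Pt) : Finset (Finset (Sym2 Pt)) :=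
  (planeGraphs S).filter (Biconnected S)

/-- `G` is a `k`-quasi-plane graph on `S`: a straight-edge graph on `S`
(crossings allowed) with no `k` pairwise crossing edges. -/
def IsQuasiPlane (k : ℕ) (S : Finset Pt) (G : Finset (Sym2 Pt)) : Prop :=
  (∀ e ∈ G, ¬ e.IsDiag ∧ ∀ p ∈ e, p ∈ S) ∧
    ¬ ∃ T ⊆ G, T.card = k ∧ ∀ e ∈ T, ∀ f ∈ T, e ≠ f → EdgesCross e f

/-- The (finite) collection of all `k`-quasi-plane graphs on `S`. -/
def qpGraphs (k : ℕ) (S : Finset Pt) : Finset (Finset (Sym2 Pt)) :=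
  S.sym2.powerset.filter (IsQuasiPlane k S)

/-- The ving `(p, G)` is an x-ving of the `k`-quasi-plane graph `G`: no straight
edge from `p` to another point of `S` can be added to `G` without violating
`k`-quasi-planarity. -/
def IsXVingQP (k : ℕ) (S : Finset Pt) (G : Finset (Sym2 Pt)) (p : Pt) : Prop :=
  ∀ q ∈ S, q ≠ p → s(p, q) ∉ G → ¬ IsQuasiPlane k S (insert s(p, q) G)

/-- `v_x(G)` for a `k`-quasi-plane graph `G`. -/
def vxQP (k : ℕ) (S : Finset Pt) (G : Finset (Sym2 Pt)) : ℕ :=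
  (S.filter (IsXVingQP k S G)).card

/-- `ĥv_x^k(S)`: the average of `v_x(G)` over a uniformly random `k`-quasi-plane
graph on `S`. -/
def hvxQP (k : ℕ) (S : Finset Pt) : ℝ :=
  (∑ G ∈ qpGraphs k S, (vxQP k S G : ℝ)) / (qpGraphs k S).card

/-- `qp_k(N)`: the maximum number of `k`-quasi-plane graphs over all sets of `N`
points in general position. -/
def qpMax (k N : ℕ) : ℕ :=
  sSup {n : ℕ | ∃ S : Finset Pt, S.card = N ∧ GenPos S ∧ (qpGraphs k S).card = n}

/-- The slope of the line `pq` in the coordinates `X`, `Y`. -/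
def sl (X Y : Pt →ₗ[ℝ] ℝ) (p q : Pt) : ℝ := (Y q - Y p) / (X q - X p)

/-- The `Y`-coordinate of the line `ab` at the `X`-coordinate `x`. -/
def ht (X Y : Pt →ₗ[ℝ] ℝ) (a b : Pt) (x : ℝ) : ℝ := Y a + sl X Y a b * (x - X a)

/-- `X`, `Y` are coordinates of the plane in which `S` is in general position and has no
vertical edges. -/
structure Good (X Y : Pt →ₗ[ℝ] ℝ) (S : Finset Pt) : Prop where
  joint : ∀ p q, X p = X q → Y p = Y q → p = q
  inj : ∀ p ∈ S, ∀ q ∈ S, X p = X q → p = q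
  gen : GenPos S

section Geometry

variable {X Y : Pt →ₗ[ℝ] ℝ} {S : Finset Pt} {G : Finset (Sym2 Pt)}

theorem Good.mono (h : Good X Y S) {T : Finset Pt} (hT : T ⊆ S) : Good X Y T :=
  ⟨h.joint, fun p hp q hq => h.inj p (hT hp) q (hT hq),
    fun p hp q hq r hr => h.gen p (hT hp) q (hT hq) r (hT hr)⟩

theorem Good.negX (h : Good X Y S) : Good (-X) Y S :=
  ⟨fun p q h1 h2 => h.joint p q (by simpa using h1) h2,
    fun p hp q hq h1 => h.inj p hp q hq (by simpa using h1), h.gen⟩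

theorem Good.negY (h : Good X Y S) : Good X (-Y) S :=
  ⟨fun p q h1 h2 => h.joint p q h1 (by simpa using h2), h.inj, h.gen⟩

theorem sl_comm (p q : Pt) : sl X Y p q = sl X Y q p := by
  unfold sl
  rw [← neg_sub (Y p), ← neg_sub (X p), neg_div_neg_eq]

theorem sl_negX (p q : Pt) : sl (-X) Y p q = -sl X Y p q := by
  simp only [sl, LinearMap.neg_apply]
  rw [← neg_sub' (X q), div_neg]

theorem sl_negY (p q : Pt) : sl X (-Y) p q = -sl X Y p q := by
  simp only [sl, LinearMap.neg_apply]
  rw [← neg_sub' (Y q), neg_div]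

theorem ht_negX (p q : Pt) (x : ℝ) : ht (-X) Y p q (-x) = ht X Y p q x := by
  simp only [ht, sl_negX, LinearMap.neg_apply]
  ring

theorem ht_left (a b : Pt) : ht X Y a b (X a) = Y a := by simp [ht]

theorem ht_right {a b : Pt} (h : X a ≠ X b) : ht X Y a b (X b) = Y b := by
  have : X b - X a ≠ 0 := sub_ne_zero.2 h.symm
  unfold ht sl
  field_simp
  ring

theorem ht_comm {a b : Pt} (h : X a ≠ X b) (x : ℝ) : ht X Y a b x = ht X Y b a x := by
  have := ht_right (Y := Y) h
  unfold ht at *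
  rw [sl_comm b a]
  linear_combination this

/-- The point of the line `ab` with `X`-coordinate `x`. -/
theorem exists_mem_openSegment {a b : Pt} {x : ℝ} (h1 : X a < x) (h2 : x < X b) :
    ∃ z ∈ openSegment ℝ a b, X z = x ∧ Y z = ht X Y a b x := by
  have h : 0 < X b - X a := by linarith
  refine ⟨((X b - x) / (X b - X a)) • a + ((x - X a) / (X b - X a)) • b,
    ⟨_, _, div_pos (by linarith) h, div_pos (by linarith) h, ?_, rfl⟩, ?_, ?_⟩
  · field_simp
    ring
  · simp only [map_add, map_smul, smul_eq_mul]
    field_simp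
    ring
  · simp only [map_add, map_smul, smul_eq_mul, ht, sl]
    field_simp
    ring

theorem mem_openSegment_ht {a b z : Pt} (h : X a < X b) (hz : z ∈ openSegment ℝ a b) :
    X a < X z ∧ X z < X b ∧ Y z = ht X Y a b (X z) := by
  obtain ⟨s, t, hs, ht', hst, rfl⟩ := hz
  obtain rfl : s = 1 - t := by linarith
  have h' : X b - X a ≠ 0 := by linarith
  simp only [map_add, map_smul, smul_eq_mul, ht, sl]
  refine ⟨by nlinarith, by nlinarith, ?_⟩
  field_simp
  ring

theorem edgesCross_mk {a b c d : Pt} :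
    EdgesCross s(a, b) s(c, d) ↔ (openSegment ℝ a b ∩ openSegment ℝ c d).Nonempty := by
  refine ⟨?_, fun h => ⟨a, b, c, d, rfl, rfl, h⟩⟩
  rintro ⟨a', b', c', d', h1, h2, h⟩
  rcases Sym2.eq_iff.1 h1 with ⟨rfl, rfl⟩ | ⟨rfl, rfl⟩ <;>
    rcases Sym2.eq_iff.1 h2 with ⟨rfl, rfl⟩ | ⟨rfl, rfl⟩
  · exact h
  · rwa [openSegment_symm ℝ c d]
  · rwa [openSegment_symm ℝ a b]
  · rwa [openSegment_symm ℝ a b, openSegment_symm ℝ c d]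

theorem EdgesCross.symm {e f : Sym2 Pt} (h : EdgesCross e f) : EdgesCross f e := by
  obtain ⟨a, b, c, d, h1, h2, h⟩ := h
  exact ⟨c, d, a, b, h2, h1, by rwa [Set.inter_comm]⟩

theorem EdgesCross.exists_ht_eq {a b c d : Pt} (h : EdgesCross s(a, b) s(c, d))
    (hab : X a < X b) (hcd : X c < X d) :
    ∃ x, X a < x ∧ x < X b ∧ X c < x ∧ x < X d ∧ ht X Y a b x = ht X Y c d x := by
  obtain ⟨z, h1, h2⟩ := edgesCross_mk.1 h
  obtain ⟨h3, h4, h5⟩ := mem_openSegment_ht (Y := Y) hab h1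
  obtain ⟨h6, h7, h8⟩ := mem_openSegment_ht (Y := Y) hcd h2
  exact ⟨X z, h3, h4, h6, h7, h5 ▸ h8⟩

theorem Good.edgesCross_of_eq (hS : Good X Y S) {a b c d : Pt} {x : ℝ}
    (h1 : X a < x) (h2 : x < X b) (h3 : X c < x) (h4 : x < X d)
    (h : ht X Y a b x = ht X Y c d x) : EdgesCross s(a, b) s(c, d) := by
  obtain ⟨z, hz, hz1, hz2⟩ := exists_mem_openSegment (Y := Y) h1 h2
  obtain ⟨w, hw, hw1, hw2⟩ := exists_mem_openSegment (Y := Y) h3 h4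
  obtain rfl := hS.joint z w (by rw [hz1, hw1]) (by rw [hz2, hw2, h])
  exact edgesCross_mk.2 ⟨z, hz, hw⟩

theorem Good.edgesCross_of_lt (hS : Good X Y S) {a b c d : Pt} {x y : ℝ} (hxy : x < y)
    (h1 : X a ≤ x) (h2 : y ≤ X b) (h3 : X c ≤ x) (h4 : y ≤ X d)
    (hx : ht X Y a b x < ht X Y c d x) (hy : ht X Y c d y < ht X Y a b y) :
    EdgesCross s(a, b) s(c, d) := by
  set u := ht X Y c d x - ht X Y a b x with hu
  set v := ht X Y a b y - ht X Y c d y with hv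
  have hu0 : 0 < u := by linarith
  have hv0 : 0 < v := by linarith
  have ht0 : 0 < u / (u + v) := by positivity
  have ht1 : u / (u + v) < 1 := by rw [div_lt_one (by linarith)]; linarith
  have hd : 0 < y - x := by linarith
  have key : (u / (u + v)) * (u + v) = u := by field_simp
  set t := u / (u + v) with htt
  have e1 : 0 < t * (y - x) := mul_pos ht0 hd
  have e2 : t * (y - x) < y - x := by nlinarith
  refine hS.edgesCross_of_eq (x := x + t * (y - x)) ?_ ?_ ?_ ?_ ?_
  · linarith
  · linarith
  · linarith
  · linarith
  · clear_value t
    rw [hu, hv] at key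
    unfold ht at *
    linear_combination key

theorem Good.ht_ne (hS : Good X Y S) {a b c : Pt} (ha : a ∈ S) (hb : b ∈ S) (hc : c ∈ S)
    (hab : a ≠ b) (hca : c ≠ a) (hcb : c ≠ b) : ht X Y a b (X c) ≠ Y c := by
  intro h
  refine hS.gen a ha b hb c hc hab hca.symm hcb.symm ?_
  have hX : X b - X a ≠ 0 := sub_ne_zero.2 fun h => hab (hS.inj b hb a ha h).symm
  rw [collinear_iff_of_mem (p₀ := a) (by simp)]
  refine ⟨b - a, ?_⟩
  simp only [Set.mem_insert_iff, Set.mem_singleton_iff, forall_eq_or_imp, forall_eq]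
  refine ⟨⟨0, by simp⟩, ⟨1, by simp⟩, (X c - X a) / (X b - X a), ?_⟩
  apply hS.joint
  · simp only [vadd_eq_add, map_add, map_smul, map_sub, smul_eq_mul]
    field_simp
    ring
  · rw [← h]
    simp only [vadd_eq_add, map_add, map_smul, map_sub, smul_eq_mul, ht, sl]
    field_simp
    ring

theorem Good.sl_inj (hS : Good X Y S) {p a b : Pt} (hp : p ∈ S) (ha : a ∈ S) (hb : b ∈ S)
    (hpa : a ≠ p) (hpb : b ≠ p) (h : sl X Y p a = sl X Y p b) : a = b := by
  by_contra hab
  refine hS.ht_ne hp ha hb hpa.symm hpb (Ne.symm hab) ?_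
  have := ht_right (X := X) (Y := Y) (a := p) (b := b)
    fun h => hpb (hS.inj p hp b hb h).symm
  rw [ht, ← h] at this
  exact this

theorem IsPlaneGraph.left_mem (hG : IsPlaneGraph S G) {a b : Pt} (h : s(a, b) ∈ G) : a ∈ S :=
  (hG.1 _ h).2 a (by simp)

theorem IsPlaneGraph.right_mem (hG : IsPlaneGraph S G) {a b : Pt} (h : s(a, b) ∈ G) : b ∈ S :=
  (hG.1 _ h).2 b (by simp)

theorem IsPlaneGraph.ne (hG : IsPlaneGraph S G) {a b : Pt} (h : s(a, b) ∈ G) : a ≠ b :=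
  fun hab => (hG.1 _ h).1 (by simpa using hab)

end Geometry

/-- The points of `S` that `p` sees in the presence of the edges `G`. -/
def vis (S : Finset Pt) (p : Pt) (G : Finset (Sym2 Pt)) : Finset Pt :=
  (S.erase p).filter fun q => ∀ e ∈ G, ¬ EdgesCross s(p, q) e

/-- The points visible from `p` to the left of `p`. -/
def lvis (X : Pt →ₗ[ℝ] ℝ) (S : Finset Pt) (p : Pt) (G : Finset (Sym2 Pt)) : Finset Pt :=
  (vis S p G).filter fun q => X q < X p

/-- The edges of `G` not incident to `p`. -/
def del (p : Pt) (G : Finset (Sym2 Pt)) : Finset (Sym2 Pt) := G.filter fun e => p ∉ e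

/-- The neighbours of `p` to the left of `p`. -/
def lnb (X : Pt →ₗ[ℝ] ℝ) (S : Finset Pt) (p : Pt) (G : Finset (Sym2 Pt)) : Finset Pt :=
  S.filter fun q => X q < X p ∧ s(p, q) ∈ G

/-- `cd` is an edge of `G` passing above `p`, as low as possible. -/
def IsRoof (X Y : Pt →ₗ[ℝ] ℝ) (p : Pt) (G : Finset (Sym2 Pt)) (c d : Pt) : Prop :=
  X c < X p ∧ X p < X d ∧ s(c, d) ∈ G ∧ Y p < ht X Y c d (X p) ∧
    ∀ c' d', X c' < X p → X p < X d' → s(c', d') ∈ G → Y p < ht X Y c' d' (X p) →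
      ht X Y c d (X p) ≤ ht X Y c' d' (X p)

/-- `v` is the topmost point, in angular order, that `p` sees to its left. -/
def IsTopmost (X Y : Pt →ₗ[ℝ] ℝ) (S : Finset Pt) (p : Pt) (G : Finset (Sym2 Pt)) (v : Pt) : Prop :=
  v ∈ lvis X S p G ∧ ∀ q ∈ lvis X S p G, sl X Y p v ≤ sl X Y p q

/-- The lowest edge above `p` starts at the topmost point that `p` sees to its left. -/
def TopRoof (X Y : Pt →ₗ[ℝ] ℝ) (S : Finset Pt) (p : Pt) (G : Finset (Sym2 Pt)) (v b : Pt) :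
    Prop :=
  IsTopmost X Y S p G v ∧ IsRoof X Y p G v b

/-- `p` is joined to the topmost point that it sees to its left, where the lowest edge above `p`
starts. -/
def Hook (X Y : Pt →ₗ[ℝ] ℝ) (S : Finset Pt) (G : Finset (Sym2 Pt)) (p : Pt) : Prop :=
  ∃ v b, s(p, v) ∈ G ∧ TopRoof X Y S p (del p G) v b

/-- `p` has no neighbours to its left, though it sees exactly one point there. -/
def Shy (X : Pt →ₗ[ℝ] ℝ) (S : Finset Pt) (G : Finset (Sym2 Pt)) (p : Pt) : Prop :=
  lnb X S p G = ∅ ∧ (lvis X S p (del p G)).card = 1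

section Wedges

variable {X Y : Pt →ₗ[ℝ] ℝ} {S : Finset Pt} {G : Finset (Sym2 Pt)}

theorem ht_lt_ht {a b c : Pt} {x : ℝ} (hx : X a < x) (h : sl X Y a b < sl X Y a c) :
    ht X Y a b x < ht X Y a c x := by
  unfold ht
  nlinarith

theorem ht_lt_ht_iff {a b c : Pt} {x : ℝ} (hx : X a < x) :
    ht X Y a b x < ht X Y a c x ↔ sl X Y a b < sl X Y a c := by
  refine ⟨fun h => ?_, ht_lt_ht hx⟩
  by_contra! h'
  unfold ht at h
  nlinarith

theorem ht_lt_ht' {p a b : Pt} {x : ℝ} (hx : x < X p) (h : sl X Y p a < sl X Y p b) :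
    ht X Y p b x < ht X Y p a x := by
  unfold ht
  nlinarith

theorem mem_vis {p q : Pt} :
    q ∈ vis S p G ↔ q ∈ S ∧ q ≠ p ∧ ∀ e ∈ G, ¬ EdgesCross s(p, q) e := by
  simp only [vis, Finset.mem_filter, Finset.mem_erase]
  tauto

theorem mem_lvis {p q : Pt} :
    q ∈ lvis X S p G ↔ q ∈ S ∧ X q < X p ∧ ∀ e ∈ G, ¬ EdgesCross s(q, p) e := by
  simp only [lvis, Finset.mem_filter, mem_vis, Sym2.eq_swap (a := p)]
  refine ⟨fun h => ⟨h.1.1, h.2, h.1.2.2⟩, fun h => ⟨⟨h.1, ?_, h.2.2⟩, h.2.1⟩⟩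
  rintro rfl
  exact lt_irrefl _ h.2.1

theorem mem_del {p : Pt} {e : Sym2 Pt} : e ∈ del p G ↔ e ∈ G ∧ p ∉ e := by
  simp [del]

theorem mk_mem_del {p a b : Pt} : s(a, b) ∈ del p G ↔ s(a, b) ∈ G ∧ p ≠ a ∧ p ≠ b := by
  simp [del]

theorem IsPlaneGraph.mem_lvis_del (hG : IsPlaneGraph S G) {p q : Pt} (h : s(q, p) ∈ G)
    (hqp : X q < X p) : q ∈ lvis X S p (del p G) := by
  refine mem_lvis.2 ⟨hG.left_mem h, hqp, fun e he => hG.2 _ h _ (mem_del.1 he).1 ?_⟩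
  rintro rfl
  exact (mem_del.1 he).2 (by simp)

/-- A segment cannot enter a wedge `b a b'` without meeting its boundary or starting in it. -/
theorem Good.not_mem_wedge (hS : Good X Y S) {a b b' c d : Pt} {M x : ℝ}
    (ha : a ∈ S) (hc : c ∈ S) (hd : d ∈ S) (hMb : M ≤ X b) (hMb' : M ≤ X b')
    (hempty : ∀ c ∈ S, X a < X c → X c < M → sl X Y a b ≤ sl X Y a c →
      sl X Y a c ≤ sl X Y a b' → False)
    (hca : c ≠ a) (h1 : ¬ EdgesCross s(c, d) s(a, b)) (h2 : ¬ EdgesCross s(c, d) s(a, b'))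
    (hcx : X c < x) (hxd : x ≤ X d) (hax : X a < x) (hxM : x ≤ M)
    (hl : ht X Y a b x < ht X Y c d x) (hu : ht X Y c d x < ht X Y a b' x) : False := by
  rcases lt_trichotomy (X c) (X a) with h | h | h
  · have hne := hS.ht_ne hc hd ha (by rintro rfl; linarith) hca.symm (by rintro rfl; linarith)
    rcases lt_or_gt_of_ne hne with h' | h'
    · exact h1 (hS.edgesCross_of_lt hax h.le hxd le_rfl (hxM.trans hMb)
        (by rwa [ht_left]) hl)
    · exact h2 (hS.edgesCross_of_lt hax le_rfl (hxM.trans hMb') h.le hxd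
        (by rwa [ht_left]) hu).symm
  · exact hca (hS.inj c hc a ha h)
  · have e : Y c = ht X Y a c (X c) := (ht_right h.ne).symm
    by_cases h3 : sl X Y a b ≤ sl X Y a c
    · by_cases h4 : sl X Y a c ≤ sl X Y a b'
      · exact hempty c hc h (by linarith) h3 h4
      · refine h2 (hS.edgesCross_of_lt hcx h.le (hxM.trans hMb') le_rfl hxd ?_ hu).symm
        rw [ht_left, e]
        exact ht_lt_ht h (not_le.1 h4)
    · refine h1 (hS.edgesCross_of_lt hcx le_rfl hxd h.le (hxM.trans hMb) ?_ hl)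
      rw [ht_left, e]
      exact ht_lt_ht h (not_le.1 h3)

/-- If the leftmost point in a wedge `b a b'` of `G` is `b`, then `a b'` is the roof of `b`. -/
theorem IsPlaneGraph.topRoof (hG : IsPlaneGraph S G) (hS : Good X Y S) {a b b' : Pt}
    (hab : s(a, b) ∈ G) (hab' : s(a, b') ∈ G) (hXb : X a < X b) (hbb' : X b < X b')
    (hsl : sl X Y a b < sl X Y a b')
    (hcons : ∀ d, s(a, d) ∈ G → X a < X d → sl X Y a b < sl X Y a d →
      sl X Y a d < sl X Y a b' → False)
    (hempty : ∀ c ∈ S, X a < X c → X c < X b → sl X Y a b ≤ sl X Y a c →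
      sl X Y a c ≤ sl X Y a b' → False) :
    TopRoof X Y S b (del b G) a b' := by
  have ha := hG.left_mem hab
  have hab0 : s(a, b') ∈ del b G :=
    mk_mem_del.2 ⟨hab', by rintro rfl; linarith, by rintro rfl; linarith⟩
  have hbelow : ht X Y a b (X b) < ht X Y a b' (X b) := ht_lt_ht hXb hsl
  have hYb : ht X Y a b (X b) = Y b := ht_right hXb.ne
  refine ⟨⟨hG.mem_lvis_del hab hXb, fun q hq => ?_⟩, hXb, hbb', hab0, by rwa [← hYb], ?_⟩
  · obtain ⟨hqS, hqb, hq⟩ := mem_lvis.1 hq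
    by_contra! h
    have hqab := hq _ hab0
    have key : ∀ x < X b, ht X Y a b x < ht X Y q b x := fun x hx => by
      rw [ht_comm hXb.ne, ht_comm hqb.ne]
      exact ht_lt_ht' hx h
    have hqb' : ht X Y q b (X b) < ht X Y a b' (X b) := by rwa [ht_right hqb.ne, ← hYb]
    rcases lt_trichotomy (X q) (X a) with h' | h' | h'
    · refine hqab (hS.edgesCross_of_lt hXb le_rfl hbb'.le h'.le le_rfl ?_ hqb').symm
      have := key (X a) hXb
      rwa [ht_left] at this ⊢
    · obtain rfl := hS.inj q hqS a ha h'
      exact lt_irrefl _ h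
    · have h1 := key (X q) hqb
      have e : ht X Y q b (X q) = ht X Y a q (X q) := by rw [ht_left, ht_right h'.ne]
      rw [e, ht_lt_ht_iff h'] at h1
      refine hqab (hS.edgesCross_of_lt hqb h'.le hbb'.le le_rfl le_rfl ?_ hqb').symm
      rw [e]
      refine ht_lt_ht h' ?_
      by_contra! h2
      exact hempty q hqS h' hqb h1.le h2
  · intro c d hc hd hcd hbcd
    by_contra! h
    obtain ⟨hcd, -, -⟩ := mk_mem_del.1 hcd
    have hca : c ≠ a := by
      rintro rfl
      rw [← hYb] at hbcd
      exact hcons d hcd (hc.trans hd) ((ht_lt_ht_iff hc).1 hbcd) ((ht_lt_ht_iff hc).1 h)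
    have hne : ∀ z, s(c, d) ≠ s(a, z) := fun z hz => by
      rcases Sym2.eq_iff.1 hz with ⟨rfl, -⟩ | ⟨rfl, rfl⟩
      · exact hca rfl
      · linarith
    exact hS.not_mem_wedge ha (hG.left_mem hcd) (hG.right_mem hcd) le_rfl hbb'.le hempty hca
      (hG.2 _ hcd _ hab (hne _)) (hG.2 _ hcd _ hab' (hne _)) hc hd.le hXb le_rfl
      (by rwa [hYb]) h

/-- If the leftmost point `p` in a wedge `b a b'` of `G` is interior, then it sees only `a` to its
left. -/
theorem IsPlaneGraph.shy (hG : IsPlaneGraph S G) (hS : Good X Y S) {a b b' p : Pt}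
    (hab : s(a, b) ∈ G) (hab' : s(a, b') ∈ G) (hp : p ∈ S) (hXp : X a < X p)
    (hpb : X p < X b) (hpb' : X p < X b')
    (hcons : ∀ d, s(a, d) ∈ G → X a < X d → sl X Y a b < sl X Y a d →
      sl X Y a d < sl X Y a b' → False)
    (hempty : ∀ c ∈ S, X a < X c → X c < X p → sl X Y a b ≤ sl X Y a c →
      sl X Y a c ≤ sl X Y a b' → False)
    (h1 : sl X Y a b < sl X Y a p) (h2 : sl X Y a p < sl X Y a b') :
    Shy X S G p ∧ a ∈ lvis X S p (del p G) := by
  have ha := hG.left_mem hab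
  have hab0 : s(a, b) ∈ del p G :=
    mk_mem_del.2 ⟨hab, by rintro rfl; linarith, by rintro rfl; linarith⟩
  have hab0' : s(a, b') ∈ del p G :=
    mk_mem_del.2 ⟨hab', by rintro rfl; linarith, by rintro rfl; linarith⟩
  have hYp : ht X Y a p (X p) = Y p := ht_right hXp.ne
  have hall : ∀ q ∈ lvis X S p (del p G), q = a := by
    intro q hq
    obtain ⟨hqS, hqp, hq⟩ := mem_lvis.1 hq
    by_contra hqa
    have e : ht X Y q p (X p) = ht X Y a p (X p) := by rw [hYp, ht_right hqp.ne]
    exact hS.not_mem_wedge ha hqS hp hpb.le hpb'.le hempty hqa (hq _ hab0) (hq _ hab0') hqp le_rfl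
      hXp le_rfl (e ▸ ht_lt_ht hXp h1) (e ▸ ht_lt_ht hXp h2)
  have hmem : a ∈ lvis X S p (del p G) := by
    refine mem_lvis.2 ⟨ha, hXp, ?_⟩
    intro e he hcr
    obtain ⟨heG, hpe⟩ := mem_del.1 he
    have main : ∀ c d, X c < X d → e = s(c, d) → False := by
      rintro c d hcd rfl
      obtain ⟨x, hx1, hx2, hx3, hx4, hx⟩ := hcr.exists_ht_eq (Y := Y) hXp hcd
      have l1 := ht_lt_ht hx1 h1
      have l2 := ht_lt_ht hx1 h2
      rw [hx] at l1 l2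
      have hca : c ≠ a := by
        rintro rfl
        exact hcons d heG hcd ((ht_lt_ht_iff hx1).1 l1) ((ht_lt_ht_iff hx1).1 l2)
      have hne : ∀ z, s(c, d) ≠ s(a, z) := fun z hz => by
        rcases Sym2.eq_iff.1 hz with ⟨rfl, -⟩ | ⟨rfl, rfl⟩
        · exact hca rfl
        · linarith
      exact hS.not_mem_wedge ha (hG.left_mem heG) (hG.right_mem heG) hpb.le hpb'.le hempty hca
        (hG.2 _ heG _ hab (hne _)) (hG.2 _ heG _ hab' (hne _)) hx3 hx4.le hx1 hx2.le l1 l2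
    induction e with
    | h c d =>
      rcases lt_trichotomy (X c) (X d) with h | h | h
      · exact main c d h rfl
      · exact hG.ne heG (hS.inj _ (hG.left_mem heG) _ (hG.right_mem heG) h)
      · exact main d c h Sym2.eq_swap
  refine ⟨⟨?_, ?_⟩, hmem⟩
  · refine Finset.eq_empty_of_forall_notMem fun q hq => ?_
    obtain ⟨hqS, hqp, hpq⟩ := Finset.mem_filter.1 hq
    rw [Sym2.eq_swap] at hpq
    obtain rfl := hall q (hG.mem_lvis_del hpq hqp)
    exact hcons p hpq hqp h1 h2
  · exact Finset.card_eq_one.2 ⟨a, Finset.eq_singleton_iff_unique_mem.2 ⟨hmem, hall⟩⟩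

theorem Good.isTopmost_unique (hS : Good X Y S) {p v v' : Pt} (hp : p ∈ S)
    (h : IsTopmost X Y S p G v) (h' : IsTopmost X Y S p G v') : v = v' := by
  have hv := mem_lvis.1 h.1
  have hv' := mem_lvis.1 h'.1
  exact hS.sl_inj hp hv.1 hv'.1 (by rintro rfl; linarith [hv.2.1])
    (by rintro rfl; linarith [hv'.2.1]) (le_antisymm (h.2 _ h'.1) (h'.2 _ h.1))

theorem Good.isRoof_unique (hS : Good X Y S) (hG : IsPlaneGraph S G) {p c d c' d' : Pt}
    (h : IsRoof X Y p G c d) (h' : IsRoof X Y p G c' d') : c = c' ∧ d = d' := by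
  obtain ⟨h1, h2, h3, h4, h5⟩ := h
  obtain ⟨h1', h2', h3', h4', h5'⟩ := h'
  have e := le_antisymm (h5 _ _ h1' h2' h3' h4') (h5' _ _ h1 h2 h3 h4)
  have : s(c, d) = s(c', d') := by
    by_contra hne
    exact hG.2 _ h3 _ h3' hne (hS.edgesCross_of_eq h1 h2 h1' h2' e)
  rcases Sym2.eq_iff.1 this with h | ⟨rfl, rfl⟩
  · exact h
  · linarith

theorem IsPlaneGraph.del (hG : IsPlaneGraph S G) (p : Pt) : IsPlaneGraph S (del p G) :=
  ⟨fun e he => hG.1 e (mem_del.1 he).1,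
    fun e he f hf => hG.2 e (mem_del.1 he).1 f (mem_del.1 hf).1⟩

/-- The edges of `G`, directed to the right, with another edge above them at their left end. -/
def wedges (X Y : Pt →ₗ[ℝ] ℝ) (S : Finset Pt) (G : Finset (Sym2 Pt)) : Finset (Pt × Pt) :=
  (S ×ˢ S).filter fun w => X w.1 < X w.2 ∧ s(w.1, w.2) ∈ G ∧
    ∃ b, s(w.1, b) ∈ G ∧ X w.1 < X b ∧ sl X Y w.1 w.2 < sl X Y w.1 b

theorem Good.sum_le_card_wedges (hS : Good X Y S) :
    ∑ p ∈ S, ((lnb (-X) S p G).card - 1) ≤ (wedges X Y S G).card := by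
  have hfst : ∀ w ∈ wedges X Y S G, w.1 ∈ S := fun w hw =>
    (Finset.mem_product.1 (Finset.mem_filter.1 hw).1).1
  rw [Finset.card_eq_sum_card_fiberwise hfst]
  refine Finset.sum_le_sum fun a ha => ?_
  rcases (lnb (-X) S a G).eq_empty_or_nonempty with h | h
  · simp [h]
  obtain ⟨m, hm, hmax⟩ := Finset.exists_max_image _ (sl X Y a) h
  have mem : ∀ q, q ∈ lnb (-X) S a G ↔ q ∈ S ∧ X a < X q ∧ s(a, q) ∈ G := fun q => by
    simp [lnb]
  rw [← Finset.card_erase_of_mem hm]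
  refine Finset.card_le_card_of_injOn (fun b => (a, b)) (fun b hb => ?_) fun b _ b' _ h => by
    simpa using h
  obtain ⟨hbm, hb⟩ := Finset.mem_erase.1 hb
  have hle := hmax b hb
  obtain ⟨hbS, hab, hbG⟩ := (mem b).1 hb
  obtain ⟨hmS, ham, hmG⟩ := (mem m).1 hm
  simp only [wedges, Finset.coe_filter, Finset.mem_filter, Finset.mem_product, Set.mem_ofPred_eq,
    and_true]
  refine ⟨⟨ha, hbS⟩, hab, hbG, m, hmG, ham, lt_of_le_of_ne hle fun h => hbm ?_⟩
  exact hS.sl_inj ha hbS hmS (by rintro rfl; linarith) (by rintro rfl; linarith) h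

/-- The ways in which a wedge is charged to a point. -/
def Charge (X Y : Pt →ₗ[ℝ] ℝ) (S : Finset Pt) (G : Finset (Sym2 Pt)) (w : Pt × Pt) :
    Pt ⊕ Pt ⊕ Pt → Prop
  | .inl p => p = w.2 ∧ ∃ b, TopRoof X Y S p (del p G) w.1 b
  | .inr (.inl p) => TopRoof X (-Y) S p (del p G) w.1 w.2
  | .inr (.inr p) => w.1 ∈ lvis X S p (del p G) ∧ sl X Y w.1 w.2 < sl X Y w.1 p ∧
      s(w.1, w.2) ∈ G ∧ w.2 ∈ S ∧ X w.1 < X w.2 ∧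
      ∀ d, s(w.1, d) ∈ G → X w.1 < X d → sl X Y w.1 d < sl X Y w.1 p →
        sl X Y w.1 d ≤ sl X Y w.1 w.2

theorem IsPlaneGraph.exists_charge (hG : IsPlaneGraph S G) (hS : Good X Y S) {w : Pt × Pt}
    (hw : w ∈ wedges X Y S G) :
    ∃ t, t ∈ (S.filter (Hook X Y S G)).disjSum
      ((S.filter (Hook X (-Y) S G)).disjSum (S.filter (Shy X S G))) ∧ Charge X Y S G w t := by
  obtain ⟨a, b⟩ := w
  simp only [wedges, Finset.mem_filter, Finset.mem_product] at hw
  obtain ⟨⟨ha, hb⟩, hXb, hab, hex⟩ := hw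
  obtain ⟨b', hb', hmin⟩ := Finset.exists_min_image
    (S.filter fun q => s(a, q) ∈ G ∧ X a < X q ∧ sl X Y a b < sl X Y a q) (sl X Y a) (by
      obtain ⟨q, hq⟩ := hex
      exact ⟨q, Finset.mem_filter.2 ⟨hG.right_mem hq.1, hq⟩⟩)
  simp only [Finset.mem_filter] at hb' hmin
  obtain ⟨hb'S, hab', hXb', hsl⟩ := hb'
  have hcons : ∀ d, s(a, d) ∈ G → X a < X d → sl X Y a b < sl X Y a d →
      sl X Y a d < sl X Y a b' → False := fun d h1 h2 h3 h4 =>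
    absurd (hmin d ⟨hG.right_mem h1, h1, h2, h3⟩) (not_le.2 h4)
  obtain ⟨p, hp, hpmin⟩ := Finset.exists_min_image
    (S.filter fun q => X a < X q ∧ sl X Y a b ≤ sl X Y a q ∧ sl X Y a q ≤ sl X Y a b') X
    ⟨b, Finset.mem_filter.2 ⟨hb, hXb, le_rfl, hsl.le⟩⟩
  simp only [Finset.mem_filter] at hp hpmin
  obtain ⟨hpS, hXp, hp1, hp2⟩ := hp
  have hempty : ∀ c ∈ S, X a < X c → X c < X p → sl X Y a b ≤ sl X Y a c →
      sl X Y a c ≤ sl X Y a b' → False := fun c h1 h2 h3 h4 h5 =>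
    absurd (hpmin c ⟨h1, h2, h4, h5⟩) (not_le.2 h3)
  have hpb : X p ≤ X b := hpmin b ⟨hb, hXb, le_rfl, hsl.le⟩
  have hpb' : X p ≤ X b' := hpmin b' ⟨hb'S, hXb', hsl.le, le_rfl⟩
  have hpa : p ≠ a := by rintro rfl; exact lt_irrefl _ hXp
  have hba : b ≠ a := by rintro rfl; exact lt_irrefl _ hXb
  have hba' : b' ≠ a := by rintro rfl; exact lt_irrefl _ hXb'
  by_cases e1 : p = b
  · subst e1
    have h : TopRoof X Y S p (_root_.del p G) a b' := hG.topRoof hS hab hab' hXb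
      (lt_of_le_of_ne hpb' fun h => by
        obtain rfl := hS.inj _ hb _ hb'S h
        exact lt_irrefl _ hsl) hsl hcons hempty
    refine ⟨.inl p, ?_, rfl, b', h⟩
    rw [Finset.inl_mem_disjSum, Finset.mem_filter]
    exact ⟨hb, a, b', by rwa [Sym2.eq_swap], h⟩
  by_cases e2 : p = b'
  · subst e2
    have h : TopRoof X (-Y) S p (_root_.del p G) a b := hG.topRoof hS.negY hab' hab hXb'
      (lt_of_le_of_ne hpb fun h => e1 (hS.inj _ hpS _ hb h)) (by simpa [sl_negY] using hsl)
      (fun d h1 h2 h3 h4 => hcons d h1 h2 (by simpa [sl_negY] using h4)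
        (by simpa [sl_negY] using h3))
      (fun d h1 h2 h3 h4 h5 => hempty d h1 h2 h3 (by simpa [sl_negY] using h5)
        (by simpa [sl_negY] using h4))
    refine ⟨.inr (.inl p), ?_, h⟩
    rw [Finset.inr_mem_disjSum, Finset.inl_mem_disjSum, Finset.mem_filter]
    exact ⟨hpS, a, b, by rwa [Sym2.eq_swap], h⟩
  have hp1' : sl X Y a b < sl X Y a p := lt_of_le_of_ne hp1 fun h =>
    e1 (hS.sl_inj ha hb hpS hba hpa h).symm
  have hp2' : sl X Y a p < sl X Y a b' := lt_of_le_of_ne hp2 fun h =>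
    e2 (hS.sl_inj ha hpS hb'S hpa hba' h)
  have h := hG.shy hS hab hab' hpS hXp (lt_of_le_of_ne hpb fun h => e1 (hS.inj _ hpS _ hb h))
    (lt_of_le_of_ne hpb' fun h => e2 (hS.inj _ hpS _ hb'S h)) hcons hempty hp1' hp2'
  refine ⟨.inr (.inr p), ?_, h.2, hp1', hab, hb, hXb, fun d h1 h2 h3 => ?_⟩
  · rw [Finset.inr_mem_disjSum, Finset.inr_mem_disjSum, Finset.mem_filter]
    exact ⟨hpS, h.1⟩
  · by_contra! h4
    exact hcons d h1 h2 h4 (h3.trans hp2')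

theorem IsPlaneGraph.charge_unique (hG : IsPlaneGraph S G) (hS : Good X Y S) {w w' : Pt × Pt}
    {t : Pt ⊕ Pt ⊕ Pt} (ht : t ∈ (S.filter (Hook X Y S G)).disjSum
      ((S.filter (Hook X (-Y) S G)).disjSum (S.filter (Shy X S G))))
    (h : Charge X Y S G w t) (h' : Charge X Y S G w' t) : w = w' := by
  obtain ⟨a, b⟩ := w
  obtain ⟨a', b'⟩ := w'
  rcases t with p | p | p
  · rw [Finset.inl_mem_disjSum, Finset.mem_filter] at ht
    obtain ⟨rfl, _, h1⟩ := h
    obtain ⟨rfl, _, h2⟩ := h'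
    exact Prod.ext (hS.isTopmost_unique ht.1 h1.1 h2.1) rfl
  · have := hS.negY.isRoof_unique (hG.del p) h.2 h'.2
    exact Prod.ext this.1 this.2
  · rw [Finset.inr_mem_disjSum, Finset.inr_mem_disjSum, Finset.mem_filter] at ht
    obtain ⟨h1, h2, h3, h4, h5, h6⟩ := h
    obtain ⟨h1', h2', h3', h4', h5', h6'⟩ := h'
    obtain ⟨z, hz⟩ := Finset.card_eq_one.1 ht.2.2
    simp only at *
    rw [hz, Finset.mem_singleton] at h1 h1'
    subst h1 h1'
    rw [hS.sl_inj (hG.left_mem h3) h4 h4' (by rintro rfl; exact lt_irrefl _ h5)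
      (by rintro rfl; exact lt_irrefl _ h5')
      (le_antisymm (h6' _ h3 h5 h2) (h6 _ h3' h5' h2'))]

theorem IsPlaneGraph.sum_lnb_le (hG : IsPlaneGraph S G) (hS : Good X Y S) :
    ∑ p ∈ S, ((lnb (-X) S p G).card - 1) ≤ (S.filter (Hook X Y S G)).card +
      ((S.filter (Hook X (-Y) S G)).card + (S.filter (Shy X S G)).card) := by
  refine hS.sum_le_card_wedges.trans ?_
  rw [← Finset.card_disjSum, ← Finset.card_disjSum]
  exact Finset.card_le_card_of_forall_subsingleton (Charge X Y S G)
    (fun w hw => hG.exists_charge hS hw)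
    fun t ht w hw w' hw' => hG.charge_unique hS ht hw.2 hw'.2

end Wedges

/-- The neighbours of `p`. -/
def nb (S : Finset Pt) (p : Pt) (G : Finset (Sym2 Pt)) : Finset Pt := S.filter fun q => s(p, q) ∈ G

/-- The lowest edge above `p` starts at the topmost point that `p` sees to its left. -/
def HasTopRoof (X Y : Pt →ₗ[ℝ] ℝ) (S : Finset Pt) (p : Pt) (G : Finset (Sym2 Pt)) : Prop :=
  ∃ v b, TopRoof X Y S p G v b

section VertexDeletion

variable {X Y : Pt →ₗ[ℝ] ℝ} {S : Finset Pt} {G : Finset (Sym2 Pt)}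

theorem mem_planeGraphs : G ∈ planeGraphs S ↔ IsPlaneGraph S G := by
  simp only [planeGraphs, Finset.mem_filter, Finset.mem_powerset, and_iff_right_iff_imp]
  exact fun h e he => Finset.mem_sym2_iff.2 (h.1 e he).2

theorem Good.not_edgesCross (hS : Good X Y S) {p a b : Pt} (hp : p ∈ S) (ha : a ∈ S) (hb : b ∈ S)
    (hpa : a ≠ p) (hpb : b ≠ p) (hab : a ≠ b) : ¬ EdgesCross s(p, a) s(p, b) := by
  intro h
  obtain ⟨z, h1, h2⟩ := edgesCross_mk.1 h
  have key : ∀ c, z ∈ openSegment ℝ p c → sl X Y p c = sl X Y p z := by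
    rintro c ⟨s, t, hs, ht, hst, rfl⟩
    obtain rfl : s = 1 - t := by linarith
    simp only [map_add, map_smul, smul_eq_mul, sl]
    rw [show (1 - t) * Y p + t * Y c - Y p = t * (Y c - Y p) by ring,
      show (1 - t) * X p + t * X c - X p = t * (X c - X p) by ring, mul_div_mul_left _ _ ht.ne']
  exact hab (hS.sl_inj hp ha hb hpa hpb ((key a h1).trans (key b h2).symm))

theorem IsPlaneGraph.del_erase (hG : IsPlaneGraph S G) (p : Pt) :
    IsPlaneGraph (S.erase p) (_root_.del p G) :=
  ⟨fun e he => ⟨(hG.1 e (mem_del.1 he).1).1, fun q hq => Finset.mem_erase.2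
      ⟨by rintro rfl; exact (mem_del.1 he).2 hq, (hG.1 e (mem_del.1 he).1).2 q hq⟩⟩,
    (hG.del p).2⟩

theorem IsPlaneGraph.nb_subset_vis (hG : IsPlaneGraph S G) (p : Pt) :
    nb S p G ⊆ vis S p (_root_.del p G) := by
  intro q hq
  obtain ⟨hqS, hq⟩ := Finset.mem_filter.1 hq
  refine mem_vis.2 ⟨hqS, (hG.ne hq).symm, fun e he => hG.2 _ hq _ (mem_del.1 he).1 ?_⟩
  rintro rfl
  exact (mem_del.1 he).2 (by simp)

theorem IsPlaneGraph.not_mem_erase {p : Pt} (hG : IsPlaneGraph (S.erase p) G) {e : Sym2 Pt}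
    (he : e ∈ G) : p ∉ e := fun h =>
  Finset.notMem_erase p S ((hG.1 e he).2 p h)

theorem IsPlaneGraph.union_star {p : Pt} (hG : IsPlaneGraph (S.erase p) G) (hS : Good X Y S)
    (hp : p ∈ S) {A : Finset Pt} (hA : A ⊆ vis S p G) :
    IsPlaneGraph S (G ∪ A.image fun q => s(p, q)) := by
  have hA' := fun q (hq : q ∈ A) => mem_vis.1 (hA hq)
  refine ⟨fun e he => ?_, fun e he f hf hef => ?_⟩
  · rcases Finset.mem_union.1 he with he | he
    · exact ⟨(hG.1 e he).1, fun q hq => Finset.mem_of_mem_erase ((hG.1 e he).2 q hq)⟩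
    · obtain ⟨q, hq, rfl⟩ := Finset.mem_image.1 he
      refine ⟨by simpa using (hA' q hq).2.1.symm, fun r hr => ?_⟩
      rcases Sym2.mem_iff.1 hr with rfl | rfl
      · exact hp
      · exact (hA' _ hq).1
  · rcases Finset.mem_union.1 he with he | he <;> rcases Finset.mem_union.1 hf with hf | hf
    · exact hG.2 e he f hf hef
    · obtain ⟨q, hq, rfl⟩ := Finset.mem_image.1 hf
      exact fun h => (hA' q hq).2.2 e he h.symm
    · obtain ⟨q, hq, rfl⟩ := Finset.mem_image.1 he
      exact (hA' q hq).2.2 f hf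
    · obtain ⟨q, hq, rfl⟩ := Finset.mem_image.1 he
      obtain ⟨r, hr, rfl⟩ := Finset.mem_image.1 hf
      exact hS.not_edgesCross hp (hA' q hq).1 (hA' r hr).1 (hA' q hq).2.1 (hA' r hr).2.1
        (by rintro rfl; exact hef rfl)

theorem Good.sum_planeGraphs (hS : Good X Y S) {p : Pt} (hp : p ∈ S)
    (F : Finset (Sym2 Pt) → Finset Pt → ℝ) :
    ∑ G ∈ planeGraphs S, F (del p G) (nb S p G) =
      ∑ G ∈ planeGraphs (S.erase p), ∑ A ∈ (vis S p G).powerset, F G A := by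
  rw [Finset.sum_sigma']
  refine Finset.sum_bij' (fun G _ => ⟨del p G, nb S p G⟩)
    (fun a _ => a.1 ∪ a.2.image fun q => s(p, q)) ?_ ?_ ?_ ?_ ?_
  · intro G hG
    rw [mem_planeGraphs] at hG
    rw [Finset.mem_sigma, mem_planeGraphs, Finset.mem_powerset]
    exact ⟨hG.del_erase p, hG.nb_subset_vis p⟩
  · rintro ⟨G, A⟩ h
    rw [Finset.mem_sigma, mem_planeGraphs, Finset.mem_powerset] at h
    exact mem_planeGraphs.2 (h.1.union_star hS hp h.2)
  · intro G hG
    rw [mem_planeGraphs] at hG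
    ext e
    simp only [Finset.mem_union, mem_del, Finset.mem_image, nb, Finset.mem_filter]
    constructor
    · rintro (h | ⟨q, h, rfl⟩)
      · exact h.1
      · exact h.2
    · intro he
      by_cases hpe : p ∈ e
      · obtain ⟨q, rfl⟩ := hpe
        exact Or.inr ⟨q, ⟨hG.right_mem he, he⟩, rfl⟩
      · exact Or.inl ⟨he, hpe⟩
  · rintro ⟨G, A⟩ h
    rw [Finset.mem_sigma, mem_planeGraphs, Finset.mem_powerset] at h
    have h1 : del p (G ∪ A.image fun q => s(p, q)) = G := by
      ext e
      simp only [Finset.mem_union, mem_del, Finset.mem_image]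
      constructor
      · rintro ⟨h | ⟨q, h, rfl⟩, hpe⟩
        · exact h
        · simp at hpe
      · exact fun he => ⟨Or.inl he, h.1.not_mem_erase he⟩
    have h2 : nb S p (G ∪ A.image fun q => s(p, q)) = A := by
      ext q
      simp only [nb, Finset.mem_filter, Finset.mem_union, Finset.mem_image]
      constructor
      · rintro ⟨-, he | ⟨r, hr, he⟩⟩
        · exact absurd (by simp) (h.1.not_mem_erase he)
        · rcases Sym2.eq_iff.1 he with ⟨-, rfl⟩ | ⟨rfl, rfl⟩ <;> exact hr
      · exact fun hq => ⟨(mem_vis.1 (h.2 hq)).1, Or.inr ⟨q, hq, rfl⟩⟩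
    exact Sigma.ext h1 (heq_of_eq h2)
  · intro G _
    rfl

theorem Good.card_planeGraphs (hS : Good X Y S) {p : Pt} (hp : p ∈ S) :
    ((planeGraphs S).card : ℝ) =
      ∑ G ∈ planeGraphs (S.erase p), 2 ^ (vis S p G).card := by
  have := hS.sum_planeGraphs hp fun _ _ => 1
  simpa using this

theorem two_mul_card_powerset_filter_mem {α : Type*} [DecidableEq α] {V : Finset α} {q : α}
    (hq : q ∈ V) :
    2 * (V.powerset.filter fun A => q ∈ A).card = 2 ^ V.card ∧
      2 * (V.powerset.filter fun A => q ∉ A).card = 2 ^ V.card := by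
  have h1 : (V.powerset.filter fun A => q ∉ A).card = 2 ^ (V.erase q).card := by
    rw [← Finset.card_powerset]
    congr 1
    ext A
    simp only [Finset.mem_filter, Finset.mem_powerset, Finset.subset_erase]
  have h2 := Finset.card_filter_add_card_filter_not (s := V.powerset) (fun A => q ∈ A)
  rw [Finset.card_powerset] at h2
  have h3 : 2 ^ V.card = 2 * 2 ^ (V.erase q).card := by
    rw [← Finset.card_erase_add_one hq, pow_succ, mul_comm]
  omega

theorem card_vis (hS : Good X Y S) {p : Pt} (hp : p ∈ S) :
    (vis S p G).card = (lvis X S p G).card + (lvis (-X) S p G).card := by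
  rw [← Finset.card_filter_add_card_filter_not (s := vis S p G) (fun q => X q < X p)]
  congr 2
  ext q
  simp only [lvis, Finset.mem_filter, not_lt, LinearMap.neg_apply, neg_lt_neg_iff]
  refine and_congr_right fun hq => ⟨fun h => lt_of_le_of_ne h fun e => ?_, le_of_lt⟩
  exact (mem_vis.1 hq).2.1 (hS.inj p hp q (mem_vis.1 hq).1 e).symm

theorem two_mul_sum_card_filter {α : Type*} [DecidableEq α] (V : Finset α) (P : α → Prop)
    [DecidablePred P] :
    2 * ∑ A ∈ V.powerset, (A.filter P).card = 2 ^ V.card * (V.filter P).card := by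
  have h : ∀ A ∈ V.powerset, (A.filter P).card =
      ∑ q ∈ V.filter P, if q ∈ A then 1 else 0 := fun A hA => by
    rw [← Finset.card_filter]
    congr 1
    ext q
    simp only [Finset.mem_filter]
    exact ⟨fun h => ⟨⟨Finset.mem_powerset.1 hA h.1, h.2⟩, h.1⟩, fun h => ⟨h.2, h.1.2⟩⟩
  rw [Finset.sum_congr rfl h, Finset.sum_comm, Finset.mul_sum, mul_comm, ← smul_eq_mul,
    ← Finset.sum_const]
  refine Finset.sum_congr rfl fun q hq => ?_
  rw [← Finset.card_filter]
  exact (two_mul_card_powerset_filter_mem (Finset.mem_filter.1 hq).1).1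

/-- Summing the wedge inequality over all choices of the neighbourhood of `p`. -/
theorem Good.sum_powerset_ge (hS : Good X Y S) {p : Pt} (hp : p ∈ S) :
    2 ^ (vis S p G).card * (((lvis (-X) S p G).card : ℝ) / 2 - 1
      - (if HasTopRoof X Y S p G then 1 else 0) / 2
      - (if HasTopRoof X (-Y) S p G then 1 else 0) / 2
      - (if (lvis X S p G).card = 1 then 1 else 0) / 2) + 2 ^ (lvis X S p G).card ≤
    ∑ A ∈ (vis S p G).powerset, ((((A.filter fun q => (-X) q < (-X) p).card - 1 : ℕ) : ℝ)
      - (if ∃ v b, v ∈ A ∧ TopRoof X Y S p G v b then 1 else 0)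
      - (if ∃ v b, v ∈ A ∧ TopRoof X (-Y) S p G v b then 1 else 0)
      - (if (A.filter fun q => X q < X p) = ∅ ∧ (lvis X S p G).card = 1 then 1 else 0)) := by
  have roof : ∀ Z, Good X Z S →
      (∑ A ∈ (vis S p G).powerset, if ∃ v b, v ∈ A ∧ TopRoof X Z S p G v b then (1 : ℝ) else 0) ≤
        2 ^ (vis S p G).card * ((if HasTopRoof X Z S p G then 1 else 0) / 2) := by
    intro Z hZ
    split_ifs with h
    · obtain ⟨v, b, h⟩ := h
      rw [← Finset.sum_filter, Finset.sum_const, nsmul_eq_mul, mul_one]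
      have h1 := (two_mul_card_powerset_filter_mem (Finset.mem_filter.1 h.1.1).1).1
      have h2 : ((vis S p G).powerset.filter fun A =>
          ∃ v b, v ∈ A ∧ TopRoof X Z S p G v b).card ≤
          ((vis S p G).powerset.filter fun A => v ∈ A).card := by
        refine Finset.card_le_card fun A hA => ?_
        obtain ⟨hA, w, c, hw, h'⟩ := Finset.mem_filter.1 hA
        rw [hZ.isTopmost_unique hp h.1 h'.1]
        exact Finset.mem_filter.2 ⟨hA, hw⟩
      have h3 : 2 * (((vis S p G).powerset.filter fun A => v ∈ A).card : ℝ) =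
        2 ^ (vis S p G).card := by exact_mod_cast h1
      have h4 := (Nat.cast_le (α := ℝ)).2 h2
      linarith
    · rw [Finset.sum_eq_zero]
      · simp
      · intro A _
        rw [if_neg]
        rintro ⟨v, b, -, h'⟩
        exact h ⟨v, b, h'⟩
  have single : (∑ A ∈ (vis S p G).powerset,
      if (A.filter fun q => X q < X p) = ∅ ∧ (lvis X S p G).card = 1 then (1 : ℝ) else 0) ≤
      2 ^ (vis S p G).card * ((if (lvis X S p G).card = 1 then 1 else 0) / 2) := by
    split_ifs with h
    · obtain ⟨a, ha⟩ := Finset.card_eq_one.1 h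
      have ha : a ∈ lvis X S p G := by simp [ha]
      rw [← Finset.sum_filter, Finset.sum_const, nsmul_eq_mul, mul_one]
      have h1 := (two_mul_card_powerset_filter_mem (Finset.mem_filter.1 ha).1).2
      have h2 : ((vis S p G).powerset.filter fun A =>
          (A.filter fun q => X q < X p) = ∅ ∧ (lvis X S p G).card = 1).card ≤
          ((vis S p G).powerset.filter fun A => a ∉ A).card := by
        refine Finset.card_le_card fun A hA => ?_
        obtain ⟨hA, hA', -⟩ := Finset.mem_filter.1 hA
        refine Finset.mem_filter.2 ⟨hA, fun haA => ?_⟩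
        have : a ∈ A.filter fun q => X q < X p :=
          Finset.mem_filter.2 ⟨haA, (Finset.mem_filter.1 ha).2⟩
        simp [hA'] at this
      have h3 : 2 * (((vis S p G).powerset.filter fun A => a ∉ A).card : ℝ) =
        2 ^ (vis S p G).card := by exact_mod_cast h1
      have h4 := (Nat.cast_le (α := ℝ)).2 h2
      linarith
    · simp [h]
  have size : (∑ A ∈ (vis S p G).powerset,
      (((A.filter fun q => (-X) q < (-X) p).card - 1 : ℕ) : ℝ)) ≥
      2 ^ (vis S p G).card * (((lvis (-X) S p G).card : ℝ) / 2 - 1) + 2 ^ (lvis X S p G).card := by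
    have h1 : ∀ A ∈ (vis S p G).powerset,
        (((A.filter fun q => (-X) q < (-X) p).card - 1 : ℕ) : ℝ) =
        (A.filter fun q => (-X) q < (-X) p).card - 1 +
          if (A.filter fun q => (-X) q < (-X) p) = ∅ then 1 else 0 := by
      intro A _
      split_ifs with h
      · rw [h]
        simp
      · rw [Nat.cast_sub (Finset.card_pos.2 (Finset.nonempty_iff_ne_empty.2 h))]
        simp
    rw [Finset.sum_congr rfl h1, Finset.sum_add_distrib, Finset.sum_sub_distrib,
      ← Finset.sum_filter, Finset.sum_const, Finset.sum_const, Finset.card_powerset]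
    have h2 : (2 : ℝ) * ∑ A ∈ (vis S p G).powerset,
        ((A.filter fun q => (-X) q < (-X) p).card : ℝ) =
        2 ^ (vis S p G).card * (lvis (-X) S p G).card := by
      exact_mod_cast two_mul_sum_card_filter (vis S p G) fun q => (-X) q < (-X) p
    have h3 : 2 ^ (lvis X S p G).card ≤ ((vis S p G).powerset.filter fun A =>
        (A.filter fun q => (-X) q < (-X) p) = ∅).card := by
      rw [← Finset.card_powerset]
      refine Finset.card_le_card fun A hA => ?_
      rw [Finset.mem_powerset] at hA
      refine Finset.mem_filter.2
        ⟨Finset.mem_powerset.2 (hA.trans (Finset.filter_subset _ _)), ?_⟩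
      refine Finset.filter_eq_empty_iff.2 fun q hq => ?_
      have := (Finset.mem_filter.1 (hA hq)).2
      simpa using this.le
    have h4 : (2 : ℝ) ^ (lvis X S p G).card ≤ ((vis S p G).powerset.filter fun A =>
        (A.filter fun q => (-X) q < (-X) p) = ∅).card := by exact_mod_cast h3
    simp only [nsmul_eq_mul, mul_one, Nat.cast_pow, Nat.cast_ofNat]
    linarith
  have r1 := roof Y hS
  have r2 := roof (-Y) hS.negY
  simp only [Finset.sum_sub_distrib]
  linarith

theorem Good.sum_le_zero (hS : Good X Y S) :
    ∑ p ∈ S, ∑ G ∈ planeGraphs (S.erase p),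
      (2 ^ (vis S p G).card * (((lvis (-X) S p G).card : ℝ) / 2 - 1
      - (if HasTopRoof X Y S p G then 1 else 0) / 2
      - (if HasTopRoof X (-Y) S p G then 1 else 0) / 2
      - (if (lvis X S p G).card = 1 then 1 else 0) / 2) + 2 ^ (lvis X S p G).card) ≤ 0 := by
  calc
    _ ≤ ∑ p ∈ S, ∑ G ∈ planeGraphs (S.erase p), ∑ A ∈ (vis S p G).powerset,
      ((((A.filter fun q => (-X) q < (-X) p).card - 1 : ℕ) : ℝ)
      - (if ∃ v b, v ∈ A ∧ TopRoof X Y S p G v b then 1 else 0)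
      - (if ∃ v b, v ∈ A ∧ TopRoof X (-Y) S p G v b then 1 else 0)
      - (if (A.filter fun q => X q < X p) = ∅ ∧ (lvis X S p G).card = 1 then 1 else 0)) :=
      Finset.sum_le_sum fun p hp => Finset.sum_le_sum fun G _ => hS.sum_powerset_ge hp
    _ = ∑ p ∈ S, ∑ G ∈ planeGraphs S, ((((lnb (-X) S p G).card - 1 : ℕ) : ℝ)
      - (if Hook X Y S G p then 1 else 0) - (if Hook X (-Y) S G p then 1 else 0)
      - (if Shy X S G p then 1 else 0)) := by
      refine Finset.sum_congr rfl fun p hp => ?_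
      rw [← hS.sum_planeGraphs hp fun G A =>
        ((((A.filter fun q => (-X) q < (-X) p).card - 1 : ℕ) : ℝ)
        - (if ∃ v b, v ∈ A ∧ TopRoof X Y S p G v b then 1 else 0)
        - (if ∃ v b, v ∈ A ∧ TopRoof X (-Y) S p G v b then 1 else 0)
        - (if (A.filter fun q => X q < X p) = ∅ ∧ (lvis X S p G).card = 1 then 1 else 0))]
      refine Finset.sum_congr rfl fun G hG => ?_
      have hl : ∀ Z : Pt →ₗ[ℝ] ℝ, ((nb S p G).filter fun q => Z q < Z p) = lnb Z S p G := by
        intro Z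
        ext q
        simp only [nb, lnb, Finset.mem_filter]
        tauto
      have hh : ∀ Z : Pt →ₗ[ℝ] ℝ,
          (∃ v b, v ∈ nb S p G ∧ TopRoof X Z S p (del p G) v b) ↔ Hook X Z S G p := by
        intro Z
        simp only [Hook, nb, Finset.mem_filter]
        refine exists_congr fun v => exists_congr fun b => ⟨fun h => ⟨h.1.2, h.2⟩, fun h =>
          ⟨⟨(mem_planeGraphs.1 hG).right_mem h.1, h.1⟩, h.2⟩⟩
      simp only [hl, hh, Shy]
      congr
    _ ≤ 0 := by
      rw [Finset.sum_comm]
      refine Finset.sum_nonpos fun G hG => ?_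
      have := (mem_planeGraphs.1 hG).sum_lnb_le hS
      rw [← Nat.cast_le (α := ℝ)] at this
      push_cast at this
      simp only [Finset.sum_sub_distrib, Finset.sum_boole]
      linarith

end VertexDeletion

/-- The potential, scaled by a factor of ten, of a vertex whose visible points on both sides are
joined by an edge, as a function of the number of visible points. -/
def potential (k : ℕ) : ℤ :=
  if k = 7 then 174 else if k = 8 then 561 else if k = 9 then 1294 else if k = 10 then 2210
    else if k = 11 then 1290 else 0

section Potential

theorem potential_nonneg (k : ℕ) : 0 ≤ potential k := by
  unfold potential
  split_ifs <;> norm_num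

theorem potential_eq (k : ℕ) : potential k = (if 7 = k then 174 else 0) +
    (if 8 = k then 561 else 0) + (if 9 = k then 1294 else 0) + (if 10 = k then 2210 else 0) +
      (if 11 = k then 1290 else 0) := by
  unfold potential
  split_ifs <;> first | rfl | omega

theorem sum_ite_add_le (a n t : ℕ) {c : ℤ} (hc : 0 ≤ c) :
    ∑ b ∈ Finset.Icc 1 n, (if t = a + b then c else 0) ≤ c := by
  rw [← Finset.sum_filter, Finset.sum_const, nsmul_eq_mul]
  have : ((Finset.Icc 1 n).filter fun b => t = a + b).card ≤ 1 := by
    refine Finset.card_le_one.2 fun x hx y hy => ?_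
    have h1 := (Finset.mem_filter.1 hx).2
    have h2 := (Finset.mem_filter.1 hy).2
    omega
  have : (((Finset.Icc 1 n).filter fun b => t = a + b).card : ℤ) ≤ 1 := by exact_mod_cast this
  nlinarith

theorem sum_potential_le (m n : ℕ) :
    ∑ x ∈ Finset.Icc 1 m ×ˢ Finset.Icc 1 n, potential (x.1 + x.2) ≤ 5529 * m := by
  rw [Finset.sum_product]
  calc
    _ ≤ ∑ a ∈ Finset.Icc 1 m, (5529 : ℤ) := by
      refine Finset.sum_le_sum fun a _ => ?_
      simp only [potential_eq, Finset.sum_add_distrib]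
      have h1 := sum_ite_add_le a n 7 (c := 174) (by norm_num)
      have h2 := sum_ite_add_le a n 8 (c := 561) (by norm_num)
      have h3 := sum_ite_add_le a n 9 (c := 1294) (by norm_num)
      have h4 := sum_ite_add_le a n 10 (c := 2210) (by norm_num)
      have h5 := sum_ite_add_le a n 11 (c := 1290) (by norm_num)
      linarith
    _ = 5529 * m := by
      rw [Finset.sum_const, Nat.card_Icc, nsmul_eq_mul, Nat.add_sub_cancel]
      ring

theorem large_potential_bound {m n : ℕ} (h : 13 ≤ m + n) :
    2 ^ (m + n) * (2280 - 250 * ((m : ℤ) + n)) +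
      100 * ∑ x ∈ Finset.Icc 1 m ×ˢ Finset.Icc 1 n, potential (x.1 + x.2) ≤ 0 := by
  have h1 := sum_potential_le m n
  have h2 : (2 : ℤ) ^ 13 ≤ 2 ^ (m + n) := pow_le_pow_right₀ (by norm_num) h
  have h3 : (13 : ℤ) ≤ (m : ℤ) + n := by exact_mod_cast h
  have h4 : (0 : ℤ) ≤ n := by positivity
  nlinarith

theorem closed_bound {m n : ℕ} (hm : 1 ≤ m) (hn : 1 ≤ n) :
    2 ^ (m + n) * (2280 - 250 * ((m : ℤ) + n)) +
      100 * ∑ x ∈ Finset.Icc 1 m ×ˢ Finset.Icc 1 n, potential (x.1 + x.2) ≤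
        200 * potential (m + n) + 50456 := by
  by_cases h : 13 ≤ m + n
  · have := large_potential_bound h
    have := potential_nonneg (m + n)
    linarith
  · have key : ∀ m ∈ Finset.range 13, ∀ n ∈ Finset.range 13, 1 ≤ m → 1 ≤ n → m + n < 13 →
        2 ^ (m + n) * (2280 - 250 * ((m : ℤ) + n)) +
        100 * ∑ x ∈ Finset.Icc 1 m ×ˢ Finset.Icc 1 n, potential (x.1 + x.2) ≤
          200 * potential (m + n) + 50456 := by decide +kernel
    exact key m (by simp; omega) n (by simp; omega) hm hn (by omega)

theorem two_pow_ite_le (m n : ℕ) : 2 ^ (m + n) * (if m = 1 then (1 : ℤ) else 0) ≤ 2 * 2 ^ n := by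
  split_ifs with h
  · subst h
    rw [pow_add]
    norm_num
  · simp

theorem open_bound (m n : ℕ) :
    2 ^ (m + n) * (1780 - 250 * ((m : ℤ) + n)) - 500 * (2 ^ n + 2 ^ m) +
      250 * 2 ^ (m + n) * ((if m = 1 then 1 else 0) + if n = 1 then 1 else 0) +
      100 * ∑ x ∈ Finset.Icc 1 m ×ˢ Finset.Icc 1 n, potential (x.1 + x.2) ≤ 50456 := by
  by_cases h : 13 ≤ m + n
  · have h0 := large_potential_bound h
    have h1 := two_pow_ite_le m n
    have h2 := two_pow_ite_le n m
    rw [add_comm n m] at h2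
    have h3 : (0 : ℤ) ≤ 2 ^ (m + n) := by positivity
    linarith
  · have key : ∀ m ∈ Finset.range 13, ∀ n ∈ Finset.range 13, m + n < 13 →
        2 ^ (m + n) * (1780 - 250 * ((m : ℤ) + n)) - 500 * (2 ^ n + 2 ^ m) +
        250 * 2 ^ (m + n) * ((if m = 1 then 1 else 0) + if n = 1 then 1 else 0) +
        100 * ∑ x ∈ Finset.Icc 1 m ×ˢ Finset.Icc 1 n, potential (x.1 + x.2) ≤ 50456 := by
      decide +kernel
    convert key m (by simp; omega) n (by simp; omega) (by omega)

end Potential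

/-- The topmost points that `p` sees on both sides are joined by an edge above `p`. -/
def Capped (X Y : Pt →ₗ[ℝ] ℝ) (S : Finset Pt) (p : Pt) (G : Finset (Sym2 Pt)) (v w : Pt) : Prop :=
  IsTopmost X Y S p G v ∧ IsTopmost (-X) Y S p G w ∧ s(v, w) ∈ G ∧ Y p < ht X Y v w (X p)

section Capped

variable {X Y : Pt →ₗ[ℝ] ℝ} {S : Finset Pt} {G : Finset (Sym2 Pt)} {p : Pt}

theorem IsTopmost.lt {v : Pt} (h : IsTopmost X Y S p G v) : X v < X p := (mem_lvis.1 h.1).2.1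

theorem Capped.negX {v w : Pt} (h : Capped X Y S p G v w) : Capped (-X) Y S p G w v := by
  obtain ⟨h1, h2, h3, h4⟩ := h
  have l1 := h1.lt
  have l2 : X p < X w := by simpa using h2.lt
  refine ⟨h2, by rwa [neg_neg], by rwa [Sym2.eq_swap], ?_⟩
  rwa [LinearMap.neg_apply, ht_negX, ht_comm (by linarith)]

theorem IsRoof.of_negX {a w : Pt} (h : IsRoof (-X) Y p G w a) : IsRoof X Y p G a w := by
  obtain ⟨h1, h2, h3, h4, h5⟩ := h
  simp only [LinearMap.neg_apply, neg_lt_neg_iff, ht_negX] at h1 h2 h4 h5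
  have e := ht_comm (Y := Y) (h2.trans h1).ne (X p)
  rw [← e] at h4
  refine ⟨h2, h1, by rwa [Sym2.eq_swap], h4, fun c d hc hd hcd h => ?_⟩
  rw [ht_comm (hc.trans hd).ne] at h ⊢
  rw [e]
  exact h5 d c hd hc (by rwa [Sym2.eq_swap]) h

theorem HasTopRoof.exists_capped (hS : Good X Y S) (hG : IsPlaneGraph (S.erase p) G)
    (h : HasTopRoof X Y S p G) (h' : HasTopRoof (-X) Y S p G) : ∃ v w, Capped X Y S p G v w := by
  obtain ⟨v, b, hv, hvb⟩ := h
  obtain ⟨w, a, hw, hwa⟩ := h'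
  obtain ⟨rfl, rfl⟩ := (hS.mono (Finset.erase_subset p S)).isRoof_unique hG hvb hwa.of_negX
  exact ⟨v, b, hv, hw, hvb.2.2.1, hvb.2.2.2.1⟩

/-- Removing the edge `vw` above `p` only uncovers points above `v`, to the left of `p`. -/
theorem Capped.lvis_eq {v w : Pt} (h : Capped X Y S p G v w) :
    lvis X S p G =
      (lvis X S p (G.erase s(v, w))).filter fun q => sl X Y p v ≤ sl X Y p q := by
  obtain ⟨h1, h2, h3, h4⟩ := h
  have hvp := h1.lt
  have hpw : X p < X w := by simpa using h2.lt
  ext q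
  simp only [Finset.mem_filter]
  constructor
  · intro hq
    obtain ⟨hqS, hqp, hq'⟩ := mem_lvis.1 hq
    exact ⟨mem_lvis.2 ⟨hqS, hqp, fun e he => hq' e (Finset.mem_of_mem_erase he)⟩, h1.2 q hq⟩
  · rintro ⟨hq, hsl⟩
    obtain ⟨hqS, hqp, hq⟩ := mem_lvis.1 hq
    refine mem_lvis.2 ⟨hqS, hqp, fun e he hcr => ?_⟩
    by_cases hev : e = s(v, w)
    · subst hev
      obtain ⟨x, hx1, hx2, hx3, hx4, hx⟩ := hcr.exists_ht_eq (Y := Y) hqp (hvp.trans hpw)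
      have e1 : ht X Y v p (X p) = Y p := ht_right hvp.ne
      rw [← e1, ht_lt_ht_iff hvp] at h4
      have l1 := ht_lt_ht hx3 h4
      rw [← hx, ht_comm hqp.ne, ht_comm hvp.ne] at l1
      unfold ht at l1
      nlinarith
    · exact hq e (Finset.mem_erase.2 ⟨hev, he⟩) hcr

theorem Capped.lvis_subset {v w : Pt} (h : Capped X Y S p G v w) :
    lvis X S p G ⊆ lvis X S p (G.erase s(v, w)) := by
  rw [h.lvis_eq]
  exact Finset.filter_subset _ _

theorem Capped.eq_of_card_eq (hS : Good X Y S) (hp : p ∈ S) {G' : Finset (Sym2 Pt)}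
    {v w v' w' : Pt} (h : Capped X Y S p G v w) (h' : Capped X Y S p G' v' w')
    (hGG : G.erase s(v, w) = G'.erase s(v', w'))
    (hc : (lvis X S p G).card = (lvis X S p G').card) : v = v' := by
  have key : lvis X S p G = lvis X S p G' := by
    have e := h.lvis_eq
    have e' := h'.lvis_eq
    rw [← hGG] at e'
    rcases le_total (sl X Y p v) (sl X Y p v') with hl | hl
    · refine (Finset.eq_of_subset_of_card_le ?_ hc.le).symm
      rw [e, e']
      exact Finset.monotone_filter_right _ fun q _ hq => hl.trans hq
    · refine Finset.eq_of_subset_of_card_le ?_ hc.ge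
      rw [e, e']
      exact Finset.monotone_filter_right _ fun q _ hq => hl.trans hq
  refine hS.isTopmost_unique hp h.1 (G := G) ?_
  unfold IsTopmost
  rw [key]
  exact h'.1

theorem Capped.card_pos {v w : Pt} (h : Capped X Y S p G v w) :
    0 < (lvis X S p G).card := Finset.card_pos.2 ⟨v, h.1.1⟩

theorem Capped.eq_of_card_erase {v w v' w' : Pt} (hS : Good X Y S) (hp : p ∈ S)
    (h : Capped X Y S p G v w) (h' : Capped X Y S p (G.erase s(v, w)) v' w')
    (hc : (lvis X S p (G.erase s(v, w))).card ≤ (lvis X S p G).card) : v = v' := by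
  have key := Finset.eq_of_subset_of_card_le h.lvis_subset hc
  refine hS.isTopmost_unique hp h.1 ?_
  unfold IsTopmost
  rw [key]
  exact h'.1

end Capped

section Transfer

variable {X Y : Pt →ₗ[ℝ] ℝ} {S : Finset Pt} {p : Pt}

/-- The sum of the potentials over the capped graphs that lose their cap to become `G`. -/
theorem Good.sum_fiber_le (hS : Good X Y S) (hp : p ∈ S) (C : Finset (Finset (Sym2 Pt)))
    (v w : Finset (Sym2 Pt) → Pt) (hC : ∀ G ∈ C, Capped X Y S p G (v G) (w G))
    (Z : Finset (Sym2 Pt)) :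
    ∑ G ∈ C.filter (fun G => G.erase s(v G, w G) = Z),
      potential ((lvis X S p G).card + (lvis (-X) S p G).card) ≤
    ∑ x ∈ (Finset.Icc 1 (lvis X S p Z).card ×ˢ Finset.Icc 1 (lvis (-X) S p Z).card),
      potential (x.1 + x.2) -
      if ∃ v w, Capped X Y S p Z v w then
        potential ((lvis X S p Z).card + (lvis (-X) S p Z).card) else 0 := by
  set F := C.filter fun G => G.erase s(v G, w G) = Z with hF
  set B := Finset.Icc 1 (lvis X S p Z).card ×ˢ Finset.Icc 1 (lvis (-X) S p Z).card with hB
  set f : Finset (Sym2 Pt) → ℕ × ℕ := fun G => ((lvis X S p G).card, (lvis (-X) S p G).card)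
    with hf
  have hcap : ∀ G ∈ F, Capped X Y S p G (v G) (w G) ∧ G.erase s(v G, w G) = Z := fun G hG =>
    ⟨hC G (Finset.mem_filter.1 hG).1, (Finset.mem_filter.1 hG).2⟩
  have hmaps : ∀ G ∈ F, f G ∈ B := by
    intro G hG
    obtain ⟨h, hZ⟩ := hcap G hG
    have h1 := Finset.card_le_card h.lvis_subset
    have h2 := Finset.card_le_card h.negX.lvis_subset
    rw [hZ] at h1
    rw [Sym2.eq_swap, hZ] at h2
    simp only [hB, hf, Finset.mem_product, Finset.mem_Icc]
    exact ⟨⟨h.card_pos, h1⟩, h.negX.card_pos, h2⟩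
  have hinj : Set.InjOn f F := by
    intro G hG G' hG' h
    obtain ⟨h1, hZ⟩ := hcap G hG
    obtain ⟨h1', hZ'⟩ := hcap G' hG'
    simp only [hf, Prod.mk.injEq] at h
    have ev := h1.eq_of_card_eq hS hp h1' (hZ.trans hZ'.symm) h.1
    have ew := h1.negX.eq_of_card_eq hS.negX hp h1'.negX
      (by rw [Sym2.eq_swap, hZ, Sym2.eq_swap, hZ']) h.2
    rw [← Finset.insert_erase h1.2.2.1, ← Finset.insert_erase h1'.2.2.1, hZ, hZ', ev, ew]
  have hsum : ∑ G ∈ F, potential ((lvis X S p G).card + (lvis (-X) S p G).card) =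
      ∑ x ∈ F.image f, potential (x.1 + x.2) := by
    rw [Finset.sum_image hinj]
  have hsub : F.image f ⊆ B := Finset.image_subset_iff.2 hmaps
  rw [hsum]
  split_ifs with hZc
  · obtain ⟨v0, w0, h0⟩ := hZc
    have htop : ((lvis X S p Z).card, (lvis (-X) S p Z).card) ∈ B := by
      simp only [hB, Finset.mem_product, Finset.mem_Icc, le_refl, and_true]
      exact ⟨h0.card_pos, h0.negX.card_pos⟩
    rw [← Finset.sum_erase_eq_sub (f := fun x : ℕ × ℕ => potential (x.1 + x.2)) htop]
    refine Finset.sum_le_sum_of_subset_of_nonneg ?_ fun x _ _ => potential_nonneg _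
    refine fun x hx => Finset.mem_erase.2 ⟨?_, hsub hx⟩
    rintro rfl
    obtain ⟨G, hG, h⟩ := Finset.mem_image.1 hx
    obtain ⟨h1, rfl⟩ := hcap G hG
    simp only [hf, Prod.mk.injEq] at h
    have ev := h1.eq_of_card_erase hS hp h0 h.1.ge
    have ew := h1.negX.eq_of_card_erase hS.negX hp (v' := w0) (w' := v0)
      (by rw [Sym2.eq_swap]; exact h0.negX) (by rw [Sym2.eq_swap]; exact h.2.ge)
    have := h0.2.2.1
    rw [← ev, ← ew] at this
    simp at this
  · rw [sub_zero]
    exact Finset.sum_le_sum_of_subset_of_nonneg hsub fun x _ _ => potential_nonneg _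

theorem IsPlaneGraph.erase {G : Finset (Sym2 Pt)} (hG : IsPlaneGraph S G) (e : Sym2 Pt) :
    IsPlaneGraph S (G.erase e) :=
  ⟨fun f hf => hG.1 f (Finset.mem_of_mem_erase hf),
    fun f hf g hg => hG.2 f (Finset.mem_of_mem_erase hf) g (Finset.mem_of_mem_erase hg)⟩

theorem Good.local_bound (hS : Good X Y S) {G : Finset (Sym2 Pt)}
    (hG : IsPlaneGraph (S.erase p) G) :
    (2 : ℝ) ^ ((lvis X S p G).card + (lvis (-X) S p G).card) *
      (1280 - 250 * (((lvis X S p G).card : ℝ) + (lvis (-X) S p G).card)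
        + 500 * (if HasTopRoof X Y S p G then 1 else 0)
        + 500 * (if HasTopRoof (-X) Y S p G then 1 else 0)
        + 250 * (if (lvis X S p G).card = 1 then 1 else 0)
        + 250 * (if (lvis (-X) S p G).card = 1 then 1 else 0))
      - 500 * 2 ^ (lvis X S p G).card - 500 * 2 ^ (lvis (-X) S p G).card
      + 100 * ((∑ x ∈ (Finset.Icc 1 (lvis X S p G).card ×ˢ Finset.Icc 1 (lvis (-X) S p G).card),
          potential (x.1 + x.2) -
        if ∃ v w, Capped X Y S p G v w then
          potential ((lvis X S p G).card + (lvis (-X) S p G).card) else 0 : ℤ) : ℝ)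
      - 100 * (if ∃ v w, Capped X Y S p G v w then
          (potential ((lvis X S p G).card + (lvis (-X) S p G).card) : ℝ) else 0) ≤ 50456 := by
  have hroof := HasTopRoof.exists_capped hS hG
  set m := (lvis X S p G).card with hm
  set n := (lvis (-X) S p G).card with hn
  have hpow : (0 : ℝ) < 2 ^ (m + n) := by positivity
  by_cases h : ∃ v w, Capped X Y S p G v w
  · rw [if_pos h, if_pos h]
    obtain ⟨v, w, h⟩ := h
    have h0 := closed_bound (hm ▸ h.card_pos) (hn ▸ h.negX.card_pos)
    have h1 := two_pow_ite_le m n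
    have h2 := two_pow_ite_le n m
    rw [add_comm n m] at h2
    rw [← Int.cast_le (R := ℝ)] at h0 h1 h2
    push_cast at h0 h1 h2 ⊢
    have l1 : (if HasTopRoof X Y S p G then (1 : ℝ) else 0) ≤ 1 := by split_ifs <;> norm_num
    have l2 : (if HasTopRoof (-X) Y S p G then (1 : ℝ) else 0) ≤ 1 := by split_ifs <;> norm_num
    have l1' := mul_le_mul_of_nonneg_left l1 hpow.le
    have l2' := mul_le_mul_of_nonneg_left l2 hpow.le
    linarith
  · rw [if_neg h, if_neg h]
    have h0 := open_bound m n
    rw [← Int.cast_le (R := ℝ)] at h0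
    push_cast at h0 ⊢
    have l : (if HasTopRoof X Y S p G then (1 : ℝ) else 0) +
        (if HasTopRoof (-X) Y S p G then (1 : ℝ) else 0) ≤ 1 := by
      split_ifs with h1 h2
      · exact absurd (hroof h1 h2) h
      all_goals norm_num
    have l' := mul_le_mul_of_nonneg_left l hpow.le
    linarith

theorem Good.slot_bound (hS : Good X Y S) (hp : p ∈ S) :
    ∑ G ∈ planeGraphs (S.erase p),
      ((2 : ℝ) ^ ((lvis X S p G).card + (lvis (-X) S p G).card) *
      (1280 - 250 * (((lvis X S p G).card : ℝ) + (lvis (-X) S p G).card)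
        + 500 * (if HasTopRoof X Y S p G then 1 else 0)
        + 500 * (if HasTopRoof (-X) Y S p G then 1 else 0)
        + 250 * (if (lvis X S p G).card = 1 then 1 else 0)
        + 250 * (if (lvis (-X) S p G).card = 1 then 1 else 0))
      - 500 * 2 ^ (lvis X S p G).card - 500 * 2 ^ (lvis (-X) S p G).card) ≤
    50456 * (planeGraphs (S.erase p)).card := by
  set P := planeGraphs (S.erase p) with hP
  set C := P.filter fun G => ∃ v w, Capped X Y S p G v w with hC
  have hex : ∀ G, ∃ v w, G ∈ C → Capped X Y S p G v w := by
    intro G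
    by_cases h : G ∈ C
    · obtain ⟨v, w, h⟩ := (Finset.mem_filter.1 h).2
      exact ⟨v, w, fun _ => h⟩
    · exact ⟨0, 0, fun h' => absurd h' h⟩
  choose v w hvw using hex
  have hmaps : ∀ G ∈ C, G.erase s(v G, w G) ∈ P := fun G hG =>
    mem_planeGraphs.2 ((mem_planeGraphs.1 (Finset.mem_filter.1 hG).1).erase _)
  have h1 := Finset.sum_fiberwise_of_maps_to hmaps
    fun G => (potential ((lvis X S p G).card + (lvis (-X) S p G).card) : ℝ)
  rw [hC, Finset.sum_filter, ← hC] at h1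
  have h2 : ∀ Z, ∑ G ∈ C.filter (fun G => G.erase s(v G, w G) = Z),
      (potential ((lvis X S p G).card + (lvis (-X) S p G).card) : ℝ) ≤
      ((∑ x ∈ (Finset.Icc 1 (lvis X S p Z).card ×ˢ Finset.Icc 1 (lvis (-X) S p Z).card),
          potential (x.1 + x.2) -
        if ∃ v w, Capped X Y S p Z v w then
          potential ((lvis X S p Z).card + (lvis (-X) S p Z).card) else 0 : ℤ) : ℝ) := by
    intro Z
    rw [← Int.cast_sum, Int.cast_le]
    exact hS.sum_fiber_le hp C v w hvw Z
  have h3 := Finset.sum_le_sum fun Z (_ : Z ∈ P) => h2 Z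
  have h4 := Finset.sum_le_sum fun Z (hZ : Z ∈ P) => hS.local_bound (mem_planeGraphs.1 hZ)
  rw [Finset.sum_const, nsmul_eq_mul] at h4
  rw [Finset.sum_sub_distrib, Finset.sum_add_distrib, ← Finset.mul_sum, ← Finset.mul_sum] at h4
  linarith

/-- On average over the choice of `p`, adding the point `p` increases the number of plane graphs
by a factor of at most `180.2`. -/
theorem Good.card_mul_le (hS : Good X Y S) :
    (S.card : ℝ) * (planeGraphs S).card ≤
      180.2 * ∑ p ∈ S, ((planeGraphs (S.erase p)).card : ℝ) := by
  have a1 := hS.sum_le_zero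
  have a2 := hS.negX.sum_le_zero
  have b1 := Finset.sum_le_sum fun p (hp : p ∈ S) => hS.slot_bound hp
  have b2 := Finset.sum_le_sum fun p (hp : p ∈ S) => hS.negY.slot_bound hp
  have c : ∑ p ∈ S, ∑ G ∈ planeGraphs (S.erase p), (560 : ℝ) * 2 ^ (vis S p G).card =
      560 * (S.card * (planeGraphs S).card) := by
    rw [← nsmul_eq_mul, ← Finset.sum_const, Finset.mul_sum]
    refine Finset.sum_congr rfl fun p hp => ?_
    rw [hS.card_planeGraphs hp, Finset.mul_sum]
  rw [← Finset.mul_sum] at b1 b2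
  have key : ∑ p ∈ S, ∑ G ∈ planeGraphs (S.erase p), (560 : ℝ) * 2 ^ (vis S p G).card ≤
      50456 * ∑ p ∈ S, ((planeGraphs (S.erase p)).card : ℝ) +
      50456 * ∑ p ∈ S, ((planeGraphs (S.erase p)).card : ℝ) + 1000 * 0 + 1000 * 0 := by
    refine le_trans (le_of_eq ?_) (add_le_add (add_le_add (add_le_add b1 b2)
      (mul_le_mul_of_nonneg_left a1 (by norm_num))) (mul_le_mul_of_nonneg_left a2 (by norm_num)))
    rw [Finset.mul_sum, Finset.mul_sum, ← Finset.sum_add_distrib, ← Finset.sum_add_distrib,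
      ← Finset.sum_add_distrib]
    refine Finset.sum_congr rfl fun p hp => ?_
    rw [Finset.mul_sum, Finset.mul_sum, ← Finset.sum_add_distrib, ← Finset.sum_add_distrib,
      ← Finset.sum_add_distrib]
    refine Finset.sum_congr rfl fun G _ => ?_
    rw [card_vis hS hp, neg_neg]
    ring
  rw [c] at key
  linarith

theorem Good.card_planeGraphs_le (n : ℕ) :
    ∀ S : Finset Pt, S.card = n → Good X Y S → ((planeGraphs S).card : ℝ) ≤ 180.2 ^ n := by
  induction n with
  | zero =>
    intro S hn hS
    rw [Finset.card_eq_zero] at hn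
    subst hn
    have : planeGraphs ∅ ⊆ {∅} := by
      intro G hG
      rw [mem_planeGraphs] at hG
      rw [Finset.mem_singleton]
      refine Finset.eq_empty_of_forall_notMem fun e he => ?_
      induction e with
      | h a b => simpa using hG.left_mem he
    have := Finset.card_le_card this
    rw [pow_zero]
    exact_mod_cast this
  | succ n ih =>
    intro S hn hS
    have h1 := hS.card_mul_le
    have h2 : ∑ p ∈ S, ((planeGraphs (S.erase p)).card : ℝ) ≤ ∑ p ∈ S, (180.2 : ℝ) ^ n :=
      Finset.sum_le_sum fun p hp => ih _ (by rw [Finset.card_erase_of_mem hp, hn]; rfl)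
        (hS.mono (Finset.erase_subset p S))
    rw [Finset.sum_const, nsmul_eq_mul] at h2
    have h3 : (0 : ℝ) < S.card := by rw [hn]; positivity
    refine le_of_mul_le_mul_left ?_ h3
    rw [pow_succ]
    linarith

end Transfer

theorem GenPos.exists_good {S : Finset Pt} (hS : GenPos S) : ∃ X Y, Good X Y S := by
  obtain ⟨c, hc⟩ := Infinite.exists_notMem_finset
    ((S ×ˢ S).image fun w => (w.1.1 - w.2.1) / (w.2.2 - w.1.2))
  refine ⟨LinearMap.fst ℝ ℝ ℝ + c • LinearMap.snd ℝ ℝ ℝ, LinearMap.snd ℝ ℝ ℝ,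
    fun p q h1 h2 => ?_, fun p hp q hq h => ?_, hS⟩
  · simp only [LinearMap.add_apply, LinearMap.smul_apply, LinearMap.fst_apply,
      LinearMap.snd_apply, smul_eq_mul] at h1 h2
    rw [h2] at h1
    exact Prod.ext (by linarith) h2
  · simp only [LinearMap.add_apply, LinearMap.smul_apply, LinearMap.fst_apply,
      LinearMap.snd_apply, smul_eq_mul] at h
    by_cases hpq : q.2 - p.2 = 0
    · have : q.2 = p.2 := by linarith
      rw [this] at h
      exact Prod.ext (by linarith) this.symm
    · refine absurd (Finset.mem_image.2 ⟨(p, q), Finset.mem_product.2 ⟨hp, hq⟩, ?_⟩) hc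
      simp only
      rw [div_eq_iff hpq]
      linarith

/-- Corollary 2.14. The number of bi-connected plane graphs on
any set `S` of `N` points in general position is `O*(180.20^N)`. -/
theorem stmt12 :
    ∃ P : Polynomial ℝ,
      ∀ (S : Finset Pt) (N : ℕ), S.card = N → GenPos S →
        ((biconnPlaneGraphs S).card : ℝ) ≤ P.eval (N : ℝ) * 180.20 ^ N := by
  refine ⟨1, fun S N hN hS => ?_⟩
  obtain ⟨X, Y, hXY⟩ := hS.exists_good
  have h1 := Good.card_planeGraphs_le N S hN hXY
  have h2 : (biconnPlaneGraphs S).card ≤ (planeGraphs S).card :=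
    Finset.card_le_card (Finset.filter_subset _ _)
  have h3 : ((biconnPlaneGraphs S).card : ℝ) ≤ (planeGraphs S).card := by exact_mod_cast h2
  rw [Polynomial.eval_one, one_mul]
  refine h3.trans (h1.trans (le_of_eq ?_))
  norm_num
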